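/- (Forward optimality characterization) A repair sequence σ (with j_p = σ(p) for p ≥ 1 and j_0 = 0) is optimal, i.e., T(σ) = min over all repair sequences τ of T(τ), if and only if both of the following hold: (i) u(V, j_n) = min over i ∈ V_c of u(V, i), and (ii) for every p ∈ {0,…,n−1}: u({j_0, j_1,…,j_{p+1}}, j_{p+1}) = u({j_0, j_1,…,j_p}, j_p) + W({j_1,…,j_p}) · d(j_p, j_{p+1}) (where for p = 0 the set {j_1,…,j_p} is empty and u({j_0}, j_0) = 0). -/

import Mathlib

/-- `W n pre S` is the number of vertices of `V_c = {1,…,n}` without power service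
when exactly the vertices in `S` have been repaired: vertices `j` having some
predecessor-or-self `i` (i.e. `pre i j`) that is not in `S`. -/
noncomputable def W (n : ℕ) (pre : ℕ → ℕ → Prop) (S : Finset ℕ) : ℕ :=
  {j | j ∈ Finset.Icc 1 n ∧ ∃ i ∈ Finset.Icc 1 n, pre i j ∧ i ∉ S}.ncard

/-- `jseq σ p` is the `p`-th visited vertex: the depot `0` for `p = 0`, and `σ p` otherwise. -/
def jseq (σ : ℕ → ℕ) (p : ℕ) : ℕ := if p = 0 then 0 else σ p

/-- Arrival time at the `p`-th visited vertex: `t_p = ∑_{q=1}^p d(j_{q-1}, j_q)`. -/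
def arrival (d : ℕ → ℕ → ℝ) (σ : ℕ → ℕ) (p : ℕ) : ℝ :=
  ∑ q ∈ Finset.Icc 1 p, d (jseq σ (q - 1)) (jseq σ q)

/-- `lastPos n pre σ i = max { p ∈ [1,n] : σ p ⪰ i }`, the position at which the
service of vertex `i` is restored. -/
noncomputable def lastPos (n : ℕ) (pre : ℕ → ℕ → Prop) (σ : ℕ → ℕ) (i : ℕ) : ℕ :=
  sSup {p : ℕ | p ∈ Finset.Icc 1 n ∧ pre (σ p) i}

/-- Total service disruption time `T(σ) = ∑_{i ∈ V_c} r_i` where `r_i = t_{p(i)}`. -/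
noncomputable def totalT (n : ℕ) (d : ℕ → ℕ → ℝ) (pre : ℕ → ℕ → Prop) (σ : ℕ → ℕ) : ℝ :=
  ∑ i ∈ Finset.Icc 1 n, arrival d σ (lastPos n pre σ i)

/-- Forward value function `u(X, i)`: the minimum over all orderings `(y_1,…,y_m)` of
`X ∖ {0}` ending at `y_m = i` (with `m = |X| − 1` and `y_0 = 0`) of
`∑_{p=1}^{m} W({y_1,…,y_{p−1}}) · d(y_{p−1}, y_p)`; in particular `u({0}, 0) = 0`. -/
noncomputable def uval (n : ℕ) (d : ℕ → ℕ → ℝ) (pre : ℕ → ℕ → Prop) (X : Finset ℕ) (i : ℕ) : ℝ :=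
  sInf { c : ℝ | ∃ y : ℕ → ℕ, Set.BijOn y (Set.Icc 1 (X.card - 1)) ↑(X.erase 0) ∧
    y (X.card - 1) = i ∧
    c = ∑ p ∈ Finset.Icc 1 (X.card - 1),
      (W n pre ((Finset.Icc 1 (p - 1)).image y) : ℝ) * d (jseq y (p - 1)) (jseq y p) }

/-- Cost of the first `m` legs of `y`, each leg weighted by the number of vertices without service
while it is travelled. -/
noncomputable def prefixCost (n : ℕ) (d : ℕ → ℕ → ℝ) (pre : ℕ → ℕ → Prop) (y : ℕ → ℕ) (m : ℕ) :
    ℝ :=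
  ∑ p ∈ Finset.Icc 1 m,
    (W n pre ((Finset.Icc 1 (p - 1)).image y) : ℝ) * d (jseq y (p - 1)) (jseq y p)

section ForwardValue

variable {n : ℕ} {d : ℕ → ℕ → ℝ} {pre : ℕ → ℕ → Prop}

theorem prefixCost_nonneg (hd : ∀ i j, 0 ≤ d i j) (y : ℕ → ℕ) (m : ℕ) :
    0 ≤ prefixCost n d pre y m :=
  Finset.sum_nonneg fun _ _ => mul_nonneg (Nat.cast_nonneg _) (hd _ _)

theorem prefixCost_succ (y : ℕ → ℕ) (m : ℕ) :
    prefixCost n d pre y (m + 1) = prefixCost n d pre y m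
      + (W n pre ((Finset.Icc 1 m).image y) : ℝ) * d (jseq y m) (y (m + 1)) := by
  simp [prefixCost, Finset.sum_Icc_succ_top, jseq]

theorem jseq_jseq (y : ℕ → ℕ) : jseq (jseq y) = jseq y := by
  funext p
  simp only [jseq]
  split_ifs <;> rfl

theorem image_jseq (y : ℕ → ℕ) (m : ℕ) :
    (Finset.Icc 1 m).image (jseq y) = (Finset.Icc 1 m).image y := by
  refine Finset.image_congr fun p hp => ?_
  have : p ≠ 0 := by
    have := (Finset.mem_Icc.1 hp).1
    omega
  simp [jseq, this]

theorem prefixCost_jseq (y : ℕ → ℕ) (m : ℕ) :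
    prefixCost n d pre (jseq y) m = prefixCost n d pre y m := by
  simp only [prefixCost, jseq_jseq, image_jseq]

theorem prefixCost_congr {y z : ℕ → ℕ} {m : ℕ} (h : ∀ p ∈ Finset.Icc 1 m, y p = z p) :
    prefixCost n d pre y m = prefixCost n d pre z m := by
  have hj : ∀ p ≤ m, jseq y p = jseq z p := by
    intro p hp
    by_cases h0 : p = 0
    · simp [jseq, h0]
    · simpa [jseq, h0] using h p (Finset.mem_Icc.2 ⟨by omega, hp⟩)
  refine Finset.sum_congr rfl fun p hp => ?_
  rw [Finset.mem_Icc] at hp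
  rw [hj p hp.2, hj (p - 1) (by omega), Finset.image_congr (g := z)]
  intro q hq
  rw [Finset.mem_coe, Finset.mem_Icc] at hq
  exact h q (Finset.mem_Icc.2 ⟨hq.1, by omega⟩)

/-- The forward value of the set visited by an injective sequence is the greatest lower bound of
the costs of the sequences with the same visited set and the same endpoint. -/
theorem isGLB_uval (hd : ∀ i j, 0 ≤ d i j) {y : ℕ → ℕ} {m : ℕ}
    (hinj : Set.InjOn y (Finset.Icc 1 m)) (h0 : ∀ p ∈ Finset.Icc 1 m, y p ≠ 0) :
    IsGLB {c : ℝ | ∃ z : ℕ → ℕ, (Finset.Icc 1 m).image z = (Finset.Icc 1 m).image y ∧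
        jseq z m = jseq y m ∧ c = prefixCost n d pre z m}
      (uval n d pre (insert 0 ((Finset.Icc 1 m).image y)) (jseq y m)) := by
  have hnot : 0 ∉ (Finset.Icc 1 m).image y := by
    simpa only [Finset.mem_image, not_exists, not_and] using h0
  have hcard : (insert 0 ((Finset.Icc 1 m).image y)).card - 1 = m := by
    rw [Finset.card_insert_of_notMem hnot, Finset.card_image_of_injOn hinj]
    simp
  have hset : {c : ℝ | ∃ z : ℕ → ℕ, (Finset.Icc 1 m).image z = (Finset.Icc 1 m).image y ∧
        jseq z m = jseq y m ∧ c = prefixCost n d pre z m} =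
      {c : ℝ | ∃ z : ℕ → ℕ, Set.BijOn z (Set.Icc 1 m) ↑((Finset.Icc 1 m).image y) ∧
        z m = jseq y m ∧ c = prefixCost n d pre z m} := by
    ext c
    constructor
    · rintro ⟨z, hz, hzm, rfl⟩
      refine ⟨jseq z, ?_, hzm, (prefixCost_jseq z m).symm⟩
      have hzj := (image_jseq z m).trans hz
      rw [← hzj, ← Finset.coe_Icc, Finset.coe_image]
      refine Set.InjOn.bijOn_image (Finset.card_image_iff.1 ?_)
      rw [hzj, Finset.card_image_of_injOn hinj]
    · rintro ⟨z, hz, hzm, rfl⟩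
      refine ⟨z, ?_, ?_, rfl⟩
      · rw [← Finset.coe_inj, ← hz.image_eq, Finset.coe_image, Finset.coe_Icc]
      · by_cases hm : m = 0
        · simp [jseq, hm]
        · rw [← hzm]
          simp [jseq, hm]
  have hu : uval n d pre (insert 0 ((Finset.Icc 1 m).image y)) (jseq y m) =
      sInf {c : ℝ | ∃ z : ℕ → ℕ, (Finset.Icc 1 m).image z = (Finset.Icc 1 m).image y ∧
        jseq z m = jseq y m ∧ c = prefixCost n d pre z m} := by
    rw [hset, uval, hcard, Finset.erase_insert hnot]
    rfl
  rw [hu]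
  refine isGLB_csInf ⟨_, y, rfl, rfl, rfl⟩ ⟨0, ?_⟩
  rintro _ ⟨z, -, -, rfl⟩
  exact prefixCost_nonneg hd z m

theorem le_lastPos_iff {σ : ℕ → ℕ} (hrefl : ∀ i ∈ Finset.Icc 1 n, pre i i)
    (hσ : Set.BijOn σ (Set.Icc 1 n) (Set.Icc 1 n)) {i q : ℕ} (hi : i ∈ Finset.Icc 1 n)
    (hq : 1 ≤ q) :
    q ≤ lastPos n pre σ i ↔
      ∃ k ∈ Finset.Icc 1 n, pre k i ∧ k ∉ (Finset.Icc 1 (q - 1)).image σ := by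
  have hne : {p : ℕ | p ∈ Finset.Icc 1 n ∧ pre (σ p) i}.Nonempty := by
    obtain ⟨p, hp, rfl⟩ := hσ.surjOn (Finset.mem_Icc.1 hi)
    exact ⟨p, Finset.mem_Icc.2 hp, hrefl _ hi⟩
  have hbdd : BddAbove {p : ℕ | p ∈ Finset.Icc 1 n ∧ pre (σ p) i} :=
    ⟨n, fun p hp => (Finset.mem_Icc.1 hp.1).2⟩
  constructor
  · intro h
    obtain ⟨hmem, hpre⟩ := Nat.sSup_mem hne hbdd
    refine ⟨_, Finset.mem_Icc.2 (hσ.mapsTo (Finset.mem_Icc.1 hmem)), hpre, fun hk => ?_⟩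
    obtain ⟨r, hr, hrk⟩ := Finset.mem_image.1 hk
    rw [Finset.mem_Icc] at hr hmem
    have hle : lastPos n pre σ i ≤ n := hmem.2
    have := hσ.injOn (show r ∈ Set.Icc 1 n from ⟨hr.1, by omega⟩) hmem hrk
    have : r = lastPos n pre σ i := this
    omega
  · rintro ⟨k, hk, hpre, hnot⟩
    obtain ⟨p, hp, rfl⟩ := hσ.surjOn (Finset.mem_Icc.1 hk)
    have hqp : q ≤ p := by
      by_contra! hlt
      exact hnot (Finset.mem_image_of_mem σ (Finset.mem_Icc.2 ⟨hp.1, by omega⟩))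
    exact hqp.trans (le_csSup hbdd ⟨Finset.mem_Icc.2 hp, hpre⟩)

theorem lastPos_le {σ : ℕ → ℕ} (i : ℕ) : lastPos n pre σ i ≤ n := by
  rcases Set.eq_empty_or_nonempty {p : ℕ | p ∈ Finset.Icc 1 n ∧ pre (σ p) i} with h | h
  · simp only [lastPos, h, csSup_empty, bot_eq_zero, zero_le]
  · exact csSup_le h fun p hp => (Finset.mem_Icc.1 hp.1).2

/-- The total service disruption time, counted leg by leg instead of vertex by vertex. -/
theorem totalT_eq_prefixCost {σ : ℕ → ℕ} (hrefl : ∀ i ∈ Finset.Icc 1 n, pre i i)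
    (hσ : Set.BijOn σ (Set.Icc 1 n) (Set.Icc 1 n)) :
    totalT n d pre σ = prefixCost n d pre σ n := by
  have harr : ∀ i, arrival d σ (lastPos n pre σ i) = ∑ q ∈ Finset.Icc 1 n,
      if q ≤ lastPos n pre σ i then d (jseq σ (q - 1)) (jseq σ q) else 0 := by
    intro i
    rw [← Finset.sum_filter, arrival]
    refine Finset.sum_congr ?_ fun _ _ => rfl
    ext q
    have := lastPos_le (n := n) (pre := pre) (σ := σ) i
    simp only [Finset.mem_Icc, Finset.mem_filter]
    omega
  simp only [totalT, harr]
  rw [Finset.sum_comm, prefixCost]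
  refine Finset.sum_congr rfl fun q hq => ?_
  rw [← Finset.sum_filter, Finset.sum_const, nsmul_eq_mul]
  congr 2
  rw [W, ← Set.ncard_coe_finset]
  congr 1
  ext i
  simp only [Finset.coe_filter, Set.mem_ofPred_eq]
  exact and_congr_right fun hi => le_lastPos_iff hrefl hσ hi (Finset.mem_Icc.1 hq).1

theorem bijOn_Icc_iff_image_eq {τ : ℕ → ℕ} :
    Set.BijOn τ (Set.Icc 1 n) (Set.Icc 1 n) ↔
      (Finset.Icc 1 n).image τ = Finset.Icc 1 n := by
  constructor
  · intro h
    rw [← Finset.coe_inj, Finset.coe_image, Finset.coe_Icc, h.image_eq]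
  · intro h
    have hinj : Set.InjOn τ (Finset.Icc 1 n) := Finset.card_image_iff.1 (by rw [h])
    have := hinj.bijOn_image
    rwa [← Finset.coe_image, h, Finset.coe_Icc] at this

/-- Replacing an initial segment of `σ` by a segment with the same visited set and the same
endpoint yields a sequence that visits the same set, and changes the cost only through that
segment. -/
theorem exists_splice {σ z : ℕ → ℕ} {m : ℕ}
    (hz : (Finset.Icc 1 m).image z = (Finset.Icc 1 m).image σ) (hzm : jseq z m = jseq σ m)
    {k : ℕ} (hk : m ≤ k) :
    ∃ τ : ℕ → ℕ, (Finset.Icc 1 k).image τ = (Finset.Icc 1 k).image σ ∧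
      prefixCost n d pre τ k - prefixCost n d pre z m =
        prefixCost n d pre σ k - prefixCost n d pre σ m := by
  let τ : ℕ → ℕ := fun q => if q ≤ m then z q else σ q
  have himg : ∀ l, m ≤ l → (Finset.Icc 1 l).image τ = (Finset.Icc 1 l).image σ := by
    intro l hl
    induction l, hl using Nat.le_induction with
    | base =>
      rw [← hz]
      exact Finset.image_congr fun q hq => if_pos (Finset.mem_Icc.1 hq).2
    | succ l hl ih =>
      have hτ : τ (l + 1) = σ (l + 1) := if_neg (by omega)
      rw [← Finset.insert_Icc_right_eq_Icc_add_one (by omega), Finset.image_insert,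
        Finset.image_insert, ih, hτ]
  refine ⟨τ, himg k hk, ?_⟩
  induction k, hk using Nat.le_induction with
  | base =>
    rw [prefixCost_congr (y := τ) (z := z) fun q hq => if_pos (Finset.mem_Icc.1 hq).2]
    ring
  | succ l hl ih =>
    have hτ : τ (l + 1) = σ (l + 1) := if_neg (by omega)
    have hj : jseq τ l = jseq σ l := by
      rcases hl.eq_or_lt with rfl | hlt
      · rw [← hzm]
        simp [jseq, τ]
      · simp [jseq, τ, Nat.not_le.2 hlt]
    rw [prefixCost_succ, prefixCost_succ, himg l hl, hj, hτ]
    linarith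

end ForwardValue

/-- **Forward optimality characterization.** A repair sequence `σ` is
optimal if and only if (i) `u(V, j_n) = min_{i ∈ V_c} u(V, i)`, and (ii) for every
`p ∈ {0,…,n−1}`,
`u({j_0,…,j_{p+1}}, j_{p+1}) = u({j_0,…,j_p}, j_p) + W({j_1,…,j_p}) · d(j_p, j_{p+1})`. -/
theorem stmt18
    (n : ℕ) (hn : 1 ≤ n)
    (d : ℕ → ℕ → ℝ) (hd : ∀ i j, 0 ≤ d i j)
    (pre : ℕ → ℕ → Prop)
    (hrefl : ∀ i ∈ Finset.Icc 1 n, pre i i)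
    (htrans : ∀ i j k, pre i j → pre j k → pre i k)
    (hantisymm : ∀ i j, pre i j → pre j i → i = j)
    (σ : ℕ → ℕ) (hσ : Set.BijOn σ (Set.Icc 1 n) (Set.Icc 1 n))
    :
    (∀ τ : ℕ → ℕ, Set.BijOn τ (Set.Icc 1 n) (Set.Icc 1 n) →
        totalT n d pre σ ≤ totalT n d pre τ)
      ↔ (uval n d pre (Finset.Icc 0 n) (σ n)
            = sInf { c : ℝ | ∃ i ∈ Finset.Icc 1 n, c = uval n d pre (Finset.Icc 0 n) i }
          ∧ ∀ p < n,
              uval n d pre (insert 0 ((Finset.Icc 1 (p + 1)).image σ)) (σ (p + 1))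
                = uval n d pre (insert 0 ((Finset.Icc 1 p).image σ)) (jseq σ p)
                  + (W n pre ((Finset.Icc 1 p).image σ) : ℝ) * d (jseq σ p) (σ (p + 1))) := by
  have hinj : ∀ {τ : ℕ → ℕ}, Set.BijOn τ (Set.Icc 1 n) (Set.Icc 1 n) → ∀ m ≤ n,
      Set.InjOn τ (Finset.Icc 1 m) := by
    intro τ hτ m hm
    rw [Finset.coe_Icc]
    exact hτ.injOn.mono (Set.Icc_subset_Icc_right hm)
  have hpos : ∀ {τ : ℕ → ℕ}, Set.BijOn τ (Set.Icc 1 n) (Set.Icc 1 n) → ∀ m ≤ n,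
      ∀ p ∈ Finset.Icc 1 m, τ p ≠ 0 := by
    intro τ hτ m hm p hp
    rw [Finset.mem_Icc] at hp
    exact Nat.one_le_iff_ne_zero.1 (hτ.mapsTo (show p ∈ Set.Icc 1 n from ⟨hp.1, by omega⟩)).1
  have hn0 : n ≠ 0 := by omega
  have hfull : ∀ {τ : ℕ → ℕ}, Set.BijOn τ (Set.Icc 1 n) (Set.Icc 1 n) →
      IsGLB {c : ℝ | ∃ z : ℕ → ℕ, (Finset.Icc 1 n).image z = (Finset.Icc 1 n).image τ ∧
        jseq z n = jseq τ n ∧ c = prefixCost n d pre z n}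
        (uval n d pre (Finset.Icc 0 n) (τ n)) := by
    intro τ hτ
    have h := isGLB_uval (n := n) (pre := pre) hd (hinj hτ n le_rfl) (hpos hτ n le_rfl)
    have hV : insert 0 ((Finset.Icc 1 n).image τ) = Finset.Icc 0 n := by
      rw [bijOn_Icc_iff_image_eq.1 hτ]
      exact Finset.insert_Icc_add_one_left_eq_Icc (Nat.zero_le n)
    have hj : jseq τ n = τ n := if_neg hn0
    rw [hV] at h
    rwa [hj] at h ⊢
  have hend : ∀ i ∈ Finset.Icc 1 n, ∃ τ : ℕ → ℕ,
      Set.BijOn τ (Set.Icc 1 n) (Set.Icc 1 n) ∧ τ n = i := by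
    intro i hi
    have hni : n ∈ Set.Icc 1 n := ⟨hn, le_rfl⟩
    exact ⟨Equiv.swap n i, Equiv.swap_bijOn_self (iff_of_true hni (Finset.mem_Icc.1 hi)), Equiv.swap_apply_left n i⟩
  have hbdd : BddBelow {c : ℝ | ∃ i ∈ Finset.Icc 1 n, c = uval n d pre (Finset.Icc 0 n) i} := by
    refine ⟨0, ?_⟩
    rintro _ ⟨i, -, rfl⟩
    refine Real.sInf_nonneg ?_
    rintro _ ⟨y, -, -, rfl⟩
    exact prefixCost_nonneg hd y _
  have hσn : σ n ∈ Finset.Icc 1 n :=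
    Finset.mem_Icc.2 (hσ.mapsTo (show n ∈ Set.Icc 1 n from ⟨hn, le_rfl⟩))
  constructor
  · intro hopt
    replace hopt : ∀ τ : ℕ → ℕ, (Finset.Icc 1 n).image τ = (Finset.Icc 1 n).image σ →
        prefixCost n d pre σ n ≤ prefixCost n d pre τ n := by
      intro τ hτ
      rw [bijOn_Icc_iff_image_eq.1 hσ] at hτ
      have h := hopt τ (bijOn_Icc_iff_image_eq.2 hτ)
      rwa [totalT_eq_prefixCost hrefl hσ,
        totalT_eq_prefixCost hrefl (bijOn_Icc_iff_image_eq.2 hτ)] at h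
    have hu : ∀ m ≤ n, uval n d pre (insert 0 ((Finset.Icc 1 m).image σ)) (jseq σ m) =
        prefixCost n d pre σ m := by
      intro m hm
      have hglb := isGLB_uval (n := n) (pre := pre) hd (hinj hσ m hm) (hpos hσ m hm)
      refine le_antisymm (hglb.1 ⟨σ, rfl, rfl, rfl⟩) (hglb.2 ?_)
      rintro _ ⟨z, hz, hzm, rfl⟩
      obtain ⟨τ, hτ, hcost⟩ := exists_splice (n := n) (d := d) (pre := pre) hz hzm hm
      linarith [hopt τ hτ]
    refine ⟨le_antisymm ?_ (csInf_le hbdd ⟨_, hσn, rfl⟩), fun p hp => ?_⟩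
    · refine le_csInf ⟨_, _, hσn, rfl⟩ ?_
      rintro _ ⟨i, hi, rfl⟩
      obtain ⟨τ, hτ, rfl⟩ := hend i hi
      refine ((hfull hσ).1 ⟨σ, rfl, rfl, rfl⟩).trans ((hfull hτ).2 ?_)
      rintro _ ⟨z, hz, -, rfl⟩
      exact hopt z (hz.trans ((bijOn_Icc_iff_image_eq.1 hτ).trans
        (bijOn_Icc_iff_image_eq.1 hσ).symm))
    · have h := hu (p + 1) hp
      rw [show jseq σ (p + 1) = σ (p + 1) from if_neg p.succ_ne_zero] at h
      rw [h, hu p hp.le, prefixCost_succ]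
  · rintro ⟨hmin, hstep⟩ τ hτ
    have hu : ∀ m ≤ n, uval n d pre (insert 0 ((Finset.Icc 1 m).image σ)) (jseq σ m) =
        prefixCost n d pre σ m := by
      intro m
      induction m with
      | zero =>
        intro hm
        have hglb := isGLB_uval (n := n) (pre := pre) hd (hinj hσ 0 hm) (hpos hσ 0 hm)
        refine le_antisymm (hglb.1 ⟨σ, rfl, rfl, rfl⟩) (hglb.2 ?_)
        rintro _ ⟨z, -, -, rfl⟩
        simp [prefixCost]
      | succ p ih =>
        intro hp
        rw [show jseq σ (p + 1) = σ (p + 1) from if_neg p.succ_ne_zero, hstep p hp,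
          ih (by omega), prefixCost_succ]
    have hglb := isGLB_uval (n := n) (pre := pre) hd (hinj hσ n le_rfl) (hpos hσ n le_rfl)
    have hσu : uval n d pre (Finset.Icc 0 n) (σ n) = prefixCost n d pre σ n := by
      refine (hfull hσ).unique ?_
      rwa [hu n le_rfl] at hglb
    have hτn : τ n ∈ Finset.Icc 1 n :=
      Finset.mem_Icc.2 (hτ.mapsTo (show n ∈ Set.Icc 1 n from ⟨hn, le_rfl⟩))
    rw [totalT_eq_prefixCost hrefl hσ, totalT_eq_prefixCost hrefl hτ, ← hσu, hmin]
    exact (csInf_le hbdd ⟨_, hτn, rfl⟩).trans ((hfull hτ).1 ⟨τ, rfl, rfl, rfl⟩)
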